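/- Let $N\ge3$ and let $\rho\in C^1([0,\infty))$ satisfy $\rho(0)=1$, condition $(\rho_0)$ with some exponent $\gamma>0$, and condition $(\rho_1)$. Let $a>0$, $b\le0$, $p=2^*$ and $q\in(1,2_*]$. Suppose $u$ is a nonnegative classical solution of problem $(\mathcal{P}_0)$ whose first- and second-order partial derivatives extend continuously to $\overline{\mathbb{R}^N_+}$, and assume $\int_{\mathbb{R}^N_+}\rho(x_N)|\nabla u|^2\,dx<\infty$, $u\in L^{2^*}(\mathbb{R}^N_+)$, $u(\cdot,0)\in L^{q}(\mathbb{R}^{N-1})$, and that the energy identity $\int_{\mathbb{R}^N_+}\rho(x_N)|\nabla u|^2\,dx=a\int_{\mathbb{R}^N_+}u^{2^*}\,dx+b\int_{\mathbb{R}^{N-1}}u(x',0)^{q}\,dx'$ holds. Then $u\equiv0$. -/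

import Mathlib

open MeasureTheory Filter
open scoped Topology ENNReal

noncomputable section

/-- The last coordinate of a point of `ℝ^N`. -/
def xN (N : ℕ) (hN : 0 < N) (x : EuclideanSpace ℝ (Fin N)) : ℝ :=
  x ⟨N - 1, Nat.sub_lt hN Nat.one_pos⟩

/-- The open upper half-space `ℝ^N₊`. -/
def Hplus (N : ℕ) (hN : 0 < N) : Set (EuclideanSpace ℝ (Fin N)) :=
  {x | 0 < xN N hN x}

/-- The point `(y, t) ∈ ℝ^N` with horizontal part `y ∈ ℝ^(N-1)` and last coordinate `t`. -/
def mkPt (N : ℕ) (y : EuclideanSpace ℝ (Fin (N - 1))) (t : ℝ) :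
    EuclideanSpace ℝ (Fin N) :=
  (WithLp.equiv 2 (Fin N → ℝ)).symm fun i => if h : (i : ℕ) < N - 1 then y ⟨(i : ℕ), h⟩ else t

/-- The boundary point `(y, 0)`. -/
def bPt (N : ℕ) (y : EuclideanSpace ℝ (Fin (N - 1))) : EuclideanSpace ℝ (Fin N) :=
  mkPt N y 0

/-- Partial derivative of `u` in the `i`-th coordinate direction. -/
def pd (N : ℕ) (u : EuclideanSpace ℝ (Fin N) → ℝ) (i : Fin N)
    (x : EuclideanSpace ℝ (Fin N)) : ℝ :=
  fderiv ℝ u x (EuclideanSpace.single i 1)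

/-- `div (w ∇u)` written as a sum of coordinate partial derivatives. -/
def divW (N : ℕ) (w u : EuclideanSpace ℝ (Fin N) → ℝ)
    (x : EuclideanSpace ℝ (Fin N)) : ℝ :=
  ∑ i, pd N (fun z => w z * pd N u i z) i x

/-- `u` is a (pointwise) solution of problem `(P₀)`:
`-div(ρ(x_N) ∇u) = a |u|^(p-2) u` in `ℝ^N₊` and
`-∂u/∂x_N = b |u|^(q-2) u` on `ℝ^(N-1)`. -/
def IsSolutionP0 (N : ℕ) (hN : 0 < N) (ρ : ℝ → ℝ) (a b p q : ℝ)
    (u : EuclideanSpace ℝ (Fin N) → ℝ) : Prop :=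
  (∀ x, 0 < xN N hN x →
    -divW N (fun z => ρ (xN N hN z)) u x = a * |u x| ^ (p - 2) * u x) ∧
  ∀ y : EuclideanSpace ℝ (Fin (N - 1)),
    -pd N u ⟨N - 1, Nat.sub_lt hN Nat.one_pos⟩ (bPt N y) =
      b * |u (bPt N y)| ^ (q - 2) * u (bPt N y)

/-! ### Geometry of the half-space -/

/-- Horizontal embedding `y ↦ (y,0)`. -/
def embL (n : ℕ) : EuclideanSpace ℝ (Fin n) →L[ℝ] EuclideanSpace ℝ (Fin (n + 1)) :=
  LinearMap.toContinuousLinearMap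
    { toFun := fun y => mkPt (n + 1) y 0
      map_add' := by
        intro y z; ext i; simp only [mkPt, WithLp.equiv_symm_apply, PiLp.add_apply]
        split <;> simp
      map_smul' := by
        intro c y; ext i; simp only [mkPt, WithLp.equiv_symm_apply, PiLp.smul_apply]
        split <;> simp }

/-- Last unit vector. -/
def eLast (n : ℕ) : EuclideanSpace ℝ (Fin (n + 1)) := EuclideanSpace.single (Fin.last n) 1

lemma embL_castSucc (n : ℕ) (y : EuclideanSpace ℝ (Fin n)) (i : Fin n) :
    embL n y i.castSucc = y i := by
  simp [embL, mkPt]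

lemma embL_last (n : ℕ) (y : EuclideanSpace ℝ (Fin n)) : embL n y (Fin.last n) = 0 := by
  simp [embL, mkPt]

lemma bPt_eq (n : ℕ) (y : EuclideanSpace ℝ (Fin n)) : bPt (n + 1) y = embL n y := rfl

lemma embL_single (n : ℕ) (i : Fin n) :
    embL n (EuclideanSpace.single i 1) = EuclideanSpace.single i.castSucc 1 := by
  ext j
  refine Fin.lastCases ?_ (fun j => ?_) j
  · rw [embL_last]; simp [Fin.castSucc_ne_last]
  · rw [embL_castSucc]; simp [Fin.castSucc_inj]

/-- Assemble a point. -/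
def asm (n : ℕ) (z : ℝ × EuclideanSpace ℝ (Fin n)) : EuclideanSpace ℝ (Fin (n + 1)) :=
  embL n z.2 + z.1 • eLast n

lemma asm_last (n : ℕ) (z : ℝ × EuclideanSpace ℝ (Fin n)) : asm n z (Fin.last n) = z.1 := by
  simp [asm, embL_last, eLast]

lemma asm_castSucc (n : ℕ) (z : ℝ × EuclideanSpace ℝ (Fin n)) (i : Fin n) :
    asm n z i.castSucc = z.2 i := by
  simp [asm, embL_castSucc, eLast, Fin.castSucc_ne_last]

lemma asm_mp (n : ℕ) : MeasurePreserving (asm n) := by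
  have h1 := (volume_preserving_piFinSuccAbove (fun _ : Fin (n + 1) => ℝ) (Fin.last n)).symm
  have h2 : MeasurePreserving (Prod.map id (WithLp.ofLp (p := 2) (V := Fin n → ℝ)) :
      ℝ × EuclideanSpace ℝ (Fin n) → ℝ × (Fin n → ℝ)) :=
    (MeasurePreserving.id volume).prod (PiLp.volume_preserving_ofLp (Fin n))
  have h3 := (PiLp.volume_preserving_toLp (Fin (n + 1))).comp (h1.comp h2)
  convert h3 using 1
  funext z
  ext i
  refine Fin.lastCases ?_ (fun j => ?_) i
  · rw [asm_last]; simp [MeasurableEquiv.piFinSuccAbove, Fin.insertNthEquiv]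
  · rw [asm_castSucc]; simp [MeasurableEquiv.piFinSuccAbove, Fin.insertNthEquiv]

lemma asm_me (n : ℕ) : MeasurableEmbedding (asm n) := by
  have h1 := (MeasurableEquiv.piFinSuccAbove (fun _ : Fin (n + 1) => ℝ) (Fin.last n)).symm
  have hc : Continuous (asm n) := by unfold asm; fun_prop
  refine hc.measurable.measurableEmbedding ?_
  intro z w h
  have hl := asm_last n z
  rw [h, asm_last] at hl
  refine Prod.ext hl.symm ?_
  ext i
  rw [← asm_castSucc, ← asm_castSucc, h]

/-- Half space with `Fin.last`. -/
def HS (n : ℕ) : Set (EuclideanSpace ℝ (Fin (n + 1))) := {x | 0 < x (Fin.last n)}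

lemma isOpen_HS (n : ℕ) : IsOpen (HS n) := by
  unfold HS
  exact isOpen_lt continuous_const (by fun_prop)

lemma asm_pre (n : ℕ) : asm n ⁻¹' (HS n) = Set.Ioi 0 ×ˢ Set.univ := by
  ext z; simp [HS, asm_last]

lemma asm_mp_HS (n : ℕ) : MeasurePreserving (asm n)
    ((volume.restrict (Set.Ioi 0)).prod volume) (volume.restrict (HS n)) := by
  have := (asm_mp n).restrict_preimage (isOpen_HS n).measurableSet
  rwa [asm_pre, Measure.volume_eq_prod, ← Measure.prod_restrict, Measure.restrict_univ] at this

lemma volume_HS (n : ℕ) : volume (HS n) = ⊤ := by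
  rw [← (asm_mp n).measure_preimage (isOpen_HS n).measurableSet.nullMeasurableSet, asm_pre,
    Measure.volume_eq_prod, Measure.prod_prod, Real.volume_Ioi]
  exact ENNReal.top_mul (isOpen_univ.measure_pos volume ⟨0, trivial⟩).ne'

lemma integral_fderiv_zero {n : ℕ} (f : EuclideanSpace ℝ (Fin n) → ℝ) (hf : ContDiff ℝ 1 f)
    (hc : HasCompactSupport f) (v : EuclideanSpace ℝ (Fin n)) :
    ∫ y, fderiv ℝ f y v = 0 := by
  obtain ⟨r, hr⟩ := hc.isCompact.isBounded.subset_closedBall 0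
  have hr' : tsupport f ⊆ Metric.closedBall 0 (max r 1) :=
    hr.trans (Metric.closedBall_subset_closedBall (le_max_left _ _))
  let χ : ContDiffBump (0 : EuclideanSpace ℝ (Fin n)) :=
    { rIn := max r 1 + 1, rOut := max r 1 + 2, rIn_pos := by positivity, rIn_lt_rOut := by linarith }
  have hχ1 : ∀ x ∈ tsupport f, χ =ᶠ[𝓝 x] 1 := by
    intro x hx
    apply χ.eventuallyEq_one_of_mem_ball
    have := hr' hx
    simp only [Metric.mem_closedBall, Metric.mem_ball] at this ⊢
    show dist x 0 < max r 1 + 1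
    linarith
  have hχd : Differentiable ℝ χ := (χ.contDiff (n := 1)).differentiable (by norm_num)
  have hfd : Differentiable ℝ f := hf.differentiable (by norm_num)
  have hf'c : Continuous (fun y => fderiv ℝ f y v) :=
    (hf.continuous_fderiv (by norm_num)).clm_apply continuous_const
  have hχ'c : Continuous (fun y => fderiv ℝ χ y v) :=
    ((χ.contDiff (n := 1)).continuous_fderiv (by norm_num)).clm_apply continuous_const
  have key := integral_mul_fderiv_eq_neg_fderiv_mul_of_integrable (𝕜 := ℝ) (f := χ) (g := f)
    (v := v) (μ := volume)
    ((hχ'c.mul hf.continuous).integrable_of_hasCompactSupport (hc.mul_left))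
    ((χ.continuous.mul hf'c).integrable_of_hasCompactSupport (χ.hasCompactSupport.mul_right))
    ((χ.continuous.mul hf.continuous).integrable_of_hasCompactSupport (hc.mul_left)) (fun x _ => hχd x) (fun x _ => hfd x)
  have e1 : (fun y => χ y * fderiv ℝ f y v) = fun y => fderiv ℝ f y v := by
    funext y
    by_cases hy : y ∈ tsupport f
    · rw [(hχ1 y hy).eq_of_nhds]; simp
    · have : fderiv ℝ f y = 0 := by
        have h0 : f =ᶠ[𝓝 y] 0 := notMem_tsupport_iff_eventuallyEq.mp hy
        rw [h0.fderiv_eq]; simp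
      simp [this]
  have e2 : (fun y => fderiv ℝ χ y v * f y) = fun y => 0 := by
    funext y
    by_cases hy : y ∈ tsupport f
    · rw [(hχ1 y hy).fderiv_eq]; simp
    · rw [image_eq_zero_of_notMem_tsupport hy]; simp
  rw [e1, e2] at key
  simpa using key

lemma emb_closed (n : ℕ) (t : ℝ) :
    Topology.IsClosedEmbedding (fun y => asm n (t, y)) := by
  have hL : Function.Injective (embL n) := by
    intro y z h; ext i; rw [← embL_castSucc n y i, ← embL_castSucc n z i, h]
  have h1 := (embL n).toLinearMap.isClosedEmbedding_of_injective (LinearMap.ker_eq_bot.mpr hL)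
  exact (Homeomorph.addRight (t • eLast n)).isClosedEmbedding.comp h1

lemma emb_closed' (n : ℕ) (y : EuclideanSpace ℝ (Fin n)) :
    Topology.IsClosedEmbedding (fun t => asm n (t, y)) := by
  have h1 := isClosedEmbedding_smul_left (𝕜 := ℝ) (c := eLast n) (by
    intro h; have := congrArg (fun x => x (Fin.last n)) h; simp [eLast] at this)
  exact (Homeomorph.addLeft (embL n y)).isClosedEmbedding.comp h1

lemma integrable_asm {n : ℕ} (g : EuclideanSpace ℝ (Fin (n + 1)) → ℝ) (hg : Continuous g)
    (hc : HasCompactSupport g) :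
    Integrable (fun z => g (asm n z)) ((volume.restrict (Set.Ioi 0)).prod volume) :=
  (asm_mp_HS n).integrable_comp_of_integrable
    (hg.integrable_of_hasCompactSupport hc).integrableOn

lemma integral_HS {n : ℕ} (g : EuclideanSpace ℝ (Fin (n + 1)) → ℝ) :
    ∫ x in HS n, g x = ∫ z, g (asm n z) ∂((volume.restrict (Set.Ioi 0)).prod volume) :=
  ((asm_mp_HS n).integral_comp (asm_me n) g).symm

lemma pd_cont {N : ℕ} {f : EuclideanSpace ℝ (Fin N) → ℝ} (hf : ContDiff ℝ 1 f) (i : Fin N) :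
    Continuous (pd N f i) :=
  (hf.continuous_fderiv (by norm_num)).clm_apply continuous_const

lemma pd_supp {N : ℕ} {f : EuclideanSpace ℝ (Fin N) → ℝ} (hf : HasCompactSupport f) (i : Fin N) :
    HasCompactSupport (pd N f i) :=
  hf.fderiv_apply (𝕜 := ℝ) _

lemma div_horiz {n : ℕ} (f : EuclideanSpace ℝ (Fin (n + 1)) → ℝ) (hf : ContDiff ℝ 1 f)
    (hc : HasCompactSupport f) (i : Fin n) :
    ∫ x in HS n, pd (n + 1) f i.castSucc x = 0 := by
  rw [integral_HS, integral_prod _ (integrable_asm _ (pd_cont hf _) (pd_supp hc _))]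
  have : ∀ t : ℝ, ∫ y, pd (n + 1) f i.castSucc (asm n (t, y)) = 0 := by
    intro t
    have hA : ∀ y, HasFDerivAt (fun y => asm n (t, y)) (embL n) y := by
      intro y
      exact ((embL n).hasFDerivAt (x := y)).add_const (t • eLast n)
    rw [← integral_fderiv_zero (fun y => f (asm n (t, y)))
      (hf.comp (by unfold asm; fun_prop)) (hc.comp_isClosedEmbedding (emb_closed n t))
      (EuclideanSpace.single i 1)]
    congr 1
    funext y
    have := ((hf.differentiable (by norm_num)) (asm n (t, y))).hasFDerivAt.comp y (hA y)
    rw [show (fun y => f (asm n (t, y))) = f ∘ fun y => asm n (t, y) from rfl, this.fderiv]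
    simp [pd, embL_single]
  simp [this]

lemma div_vert {n : ℕ} (f : EuclideanSpace ℝ (Fin (n + 1)) → ℝ) (hf : ContDiff ℝ 1 f)
    (hc : HasCompactSupport f) :
    ∫ x in HS n, pd (n + 1) f (Fin.last n) x = - ∫ y, f (embL n y) := by
  rw [integral_HS, integral_prod_symm _ (integrable_asm _ (pd_cont hf _) (pd_supp hc _)),
    ← integral_neg]
  congr 1
  funext y
  have hcd : ContDiff ℝ 1 (fun t => f (asm n (t, y))) := hf.comp (by unfold asm; fun_prop)
  have := HasCompactSupport.integral_Ioi_deriv_eq hcd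
    (hc.comp_isClosedEmbedding (emb_closed' n y)) 0
  have e : asm n (0, y) = embL n y := by simp [asm]
  rw [e] at this
  rw [← this]
  congr 1
  funext t
  have hA : HasDerivAt (fun t => asm n (t, y)) (eLast n) t := by
    unfold asm
    simpa using ((hasDerivAt_id t).smul_const (eLast n)).const_add (embL n y)
  have := ((hf.differentiable (by norm_num)) (asm n (t, y))).hasFDerivAt.comp_hasDerivAt t hA
  rw [show (fun t => f (asm n (t, y))) = f ∘ fun t => asm n (t, y) from rfl, this.deriv]
  simp [pd, eLast]

/-- Divergence theorem in the half-space. -/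
lemma div_thm {n : ℕ} (F : Fin (n + 1) → EuclideanSpace ℝ (Fin (n + 1)) → ℝ)
    (hf : ∀ i, ContDiff ℝ 1 (F i)) (hc : ∀ i, HasCompactSupport (F i)) :
    ∫ x in HS n, ∑ i, pd (n + 1) (F i) i x = - ∫ y, F (Fin.last n) (embL n y) := by
  rw [integral_finsetSum _ (fun i _ => ((pd_cont (hf i) i).integrable_of_hasCompactSupport
    (pd_supp (hc i) i)).integrableOn), Fin.sum_univ_castSucc, div_vert _ (hf _) (hc _)]
  simp [div_horiz _ (hf _) (hc _)]

/-! ### Calculus -/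

section calculus

variable {N : ℕ} {f g : EuclideanSpace ℝ (Fin N) → ℝ} {x : EuclideanSpace ℝ (Fin N)}

lemma pd_mul (hf : DifferentiableAt ℝ f x) (hg : DifferentiableAt ℝ g x) (i : Fin N) :
    pd N (fun z => f z * g z) i x = pd N f i x * g x + f x * pd N g i x := by
  unfold pd
  rw [fderiv_fun_mul hf hg]
  simp; ring

lemma pd_add (hf : DifferentiableAt ℝ f x) (hg : DifferentiableAt ℝ g x) (i : Fin N) :
    pd N (fun z => f z + g z) i x = pd N f i x + pd N g i x := by
  unfold pd
  rw [fderiv_fun_add hf hg]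
  simp

lemma pd_const_mul (c : ℝ) (hf : DifferentiableAt ℝ f x) (i : Fin N) :
    pd N (fun z => c * f z) i x = c * pd N f i x := by
  unfold pd
  rw [fderiv_const_mul hf]
  simp

lemma pd_sum {F : Fin N → EuclideanSpace ℝ (Fin N) → ℝ}
    (hf : ∀ j, DifferentiableAt ℝ (F j) x) (i : Fin N) :
    pd N (fun z => ∑ j, F j z) i x = ∑ j, pd N (F j) i x := by
  unfold pd
  rw [fderiv_fun_sum (fun j _ => hf j)]
  simp

lemma pd_coord (i j : Fin N) : pd N (fun z => z j) i x = if j = i then 1 else 0 := by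
  have : HasFDerivAt (fun z : EuclideanSpace ℝ (Fin N) => z j) (EuclideanSpace.proj (𝕜 := ℝ) j) x :=
    (EuclideanSpace.proj (𝕜 := ℝ) j).hasFDerivAt
  unfold pd
  rw [this.fderiv]
  simp

lemma pd_comp {r : ℝ → ℝ} {r' : ℝ} (hr : HasDerivAt r r' (f x)) (hf : DifferentiableAt ℝ f x)
    (i : Fin N) : pd N (fun z => r (f z)) i x = r' * pd N f i x := by
  unfold pd
  have := hr.comp_hasFDerivAt x hf.hasFDerivAt
  rw [show (fun z => r (f z)) = r ∘ f from rfl, this.fderiv]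
  simp

lemma pd_scale {e : ℝ} (hf : DifferentiableAt ℝ f (e • x)) (i : Fin N) :
    pd N (fun z => f (e • z)) i x = e * pd N f i (e • x) := by
  unfold pd
  have h1 : HasFDerivAt (fun z : EuclideanSpace ℝ (Fin N) => e • z)
    (e • ContinuousLinearMap.id ℝ _) x := (hasFDerivAt_id x).const_smul e
  have := hf.hasFDerivAt.comp x h1
  rw [show (fun z => f (e • z)) = f ∘ fun z => e • z from rfl, this.fderiv]
  simp

lemma pd_cd (hf : ContDiff ℝ 2 f) (i : Fin N) : ContDiff ℝ 1 (pd N f i) :=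
  (hf.fderiv_right (m := 1) (by norm_num)).clm_apply contDiff_const

lemma pd_symm (hf : ContDiff ℝ 2 f) (i j : Fin N) :
    pd N (pd N f i) j x = pd N (pd N f j) i x := by
  have hs : IsSymmSndFDerivAt ℝ f x := hf.contDiffAt.isSymmSndFDerivAt (by simp)
  have hd : DifferentiableAt ℝ (fderiv ℝ f) x :=
    ((hf.fderiv_right (m := 1) (by norm_num)).differentiable (by norm_num)) x
  have h : ∀ i j : Fin N, pd N (pd N f i) j x =
      fderiv ℝ (fderiv ℝ f) x (EuclideanSpace.single j 1) (EuclideanSpace.single i 1) := by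
    intro i j
    unfold pd
    rw [fderiv_clm_apply hd (differentiableAt_const _)]
    simp
  rw [h, h]
  exact hs _ _

lemma norm_gradient_sq :
    ‖gradient f x‖ ^ 2 = ∑ j, pd N f j x ^ 2 := by
  rw [EuclideanSpace.norm_sq_eq]
  refine Finset.sum_congr rfl fun j _ => ?_
  have : gradient f x j = pd N f j x := by
    have h := inner_gradient_left (f := f) (x := x) (y := EuclideanSpace.single j (1 : ℝ))
    rw [EuclideanSpace.inner_single_right] at h
    simpa [pd] using h
  rw [this, Real.norm_eq_abs, sq_abs]

end calculus

/-- Squared gradient. -/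
def gsq {n : ℕ} (u : EuclideanSpace ℝ (Fin (n + 1)) → ℝ) (x : EuclideanSpace ℝ (Fin (n + 1))) : ℝ :=
  ∑ j, pd (n + 1) u j x ^ 2

/-- `x · ∇u`. -/
def Sdot {n : ℕ} (u : EuclideanSpace ℝ (Fin (n + 1)) → ℝ)
    (x : EuclideanSpace ℝ (Fin (n + 1))) : ℝ :=
  ∑ j, x j * pd (n + 1) u j x

/-- Lagrangian density. -/
def Tlag {n : ℕ} (ρ : ℝ → ℝ) (a p : ℝ) (u : EuclideanSpace ℝ (Fin (n + 1)) → ℝ)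
    (x : EuclideanSpace ℝ (Fin (n + 1))) : ℝ :=
  (-1 / 2) * (ρ (x (Fin.last n)) * gsq u x) + a / p * u x ^ p

/-- Pohozaev vector field. -/
def Vfield {n : ℕ} (ρ : ℝ → ℝ) (a p : ℝ) (u : EuclideanSpace ℝ (Fin (n + 1)) → ℝ)
    (i : Fin (n + 1)) (x : EuclideanSpace ℝ (Fin (n + 1))) : ℝ :=
  (ρ (x (Fin.last n)) * pd (n + 1) u i x) * Sdot u x + Tlag ρ a p u x * x i

section field

variable {n : ℕ} {ρ : ℝ → ℝ} {a p : ℝ} {u : EuclideanSpace ℝ (Fin (n + 1)) → ℝ}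

lemma cd_coord {N : ℕ} (i : Fin N) :
    ContDiff ℝ 1 (fun z : EuclideanSpace ℝ (Fin N) => z i) := by fun_prop

lemma cd_w (hρ : ContDiff ℝ 1 ρ) :
    ContDiff ℝ 1 (fun z : EuclideanSpace ℝ (Fin (n + 1)) => ρ (z (Fin.last n))) :=
  hρ.comp (cd_coord _)

lemma cd_gsq (hu : ContDiff ℝ 2 u) : ContDiff ℝ 1 (gsq u) :=
  ContDiff.sum fun j _ => (pd_cd hu j).pow 2

lemma cd_Sdot (hu : ContDiff ℝ 2 u) : ContDiff ℝ 1 (Sdot u) :=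
  ContDiff.sum fun j _ => (cd_coord j).mul (pd_cd hu j)

lemma cd_pow {N : ℕ} {u : EuclideanSpace ℝ (Fin N) → ℝ} (hp : 1 < p) (hu : ContDiff ℝ 2 u) :
    ContDiff ℝ 1 (fun x => u x ^ p) := by
  have := Real.contDiff_rpow_const_of_le (p := p) (n := 1) (by simpa using hp.le)
  exact ContDiff.comp (g := fun s : ℝ => s ^ p) (by exact_mod_cast this)
    (hu.of_le (by norm_num))

lemma cd_Tlag (hρ : ContDiff ℝ 1 ρ) (hp : 1 < p) (hu : ContDiff ℝ 2 u) :
    ContDiff ℝ 1 (Tlag ρ a p u) :=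
  (contDiff_const.mul ((cd_w hρ).mul (cd_gsq hu))).add (contDiff_const.mul (cd_pow hp hu))

lemma cd_V (hρ : ContDiff ℝ 1 ρ) (hp : 1 < p) (hu : ContDiff ℝ 2 u) (i : Fin (n + 1)) :
    ContDiff ℝ 1 (Vfield ρ a p u i) :=
  (((cd_w hρ).mul (pd_cd hu i)).mul (cd_Sdot hu)).add ((cd_Tlag hρ hp hu).mul (cd_coord i))

lemma alg_aux {m : ℕ} (l : Fin m) (x U : Fin m → ℝ) (H : Fin m → Fin m → ℝ)
    (hH : ∀ i j, H i j = H j i) (W' : Fin m → ℝ) (w w' c P k : ℝ)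
    (hW : ∑ i, W' i = - (k * c)) :
    ∑ i, ((W' i * ∑ j, x j * U j) + (w * U i) * (∑ j, ((if j = i then 1 else 0) * U j + x j * H j i))
      + (((-1 / 2) * ((w' * (if l = i then 1 else 0)) * (∑ j, U j ^ 2) + w * ∑ j, 2 * U j * H j i)
        + k * c * U i) * x i + ((-1 / 2) * (w * ∑ j, U j ^ 2) + P) * 1))
    = - (((m : ℝ) - 2) / 2) * (w * ∑ j, U j ^ 2) + m * P - (1 / 2) * (x l * w' * ∑ j, U j ^ 2) := by
  have e1 : ∀ i, (∑ j, ((if j = i then (1 : ℝ) else 0) * U j + x j * H j i)) =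
      U i + ∑ j, x j * H j i := by
    intro i; rw [Finset.sum_add_distrib]; simp
  simp_rw [e1]
  set G := ∑ j, U j ^ 2 with hG
  set S := ∑ j, x j * U j with hS
  have e2 : ∑ i, (w * U i) * (U i + ∑ j, x j * H j i) =
      w * G + w * ∑ i, ∑ j, U i * x j * H j i := by
    rw [hG, Finset.mul_sum, Finset.mul_sum, ← Finset.sum_add_distrib]
    refine Finset.sum_congr rfl fun i _ => ?_
    rw [mul_add, Finset.mul_sum, Finset.mul_sum]
    congr 1
    · ring
    · exact Finset.sum_congr rfl fun j _ => by ring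
  have e3 : ∑ i, (∑ j, 2 * U j * H j i) * x i = 2 * ∑ i, ∑ j, U i * x j * H j i := by
    simp_rw [Finset.sum_mul]
    rw [Finset.sum_comm, Finset.mul_sum]
    refine Finset.sum_congr rfl fun i _ => ?_
    rw [Finset.mul_sum]
    refine Finset.sum_congr rfl fun j _ => ?_
    rw [hH i j]; ring
  have e4 : ∑ i, (w' * (if l = i then (1 : ℝ) else 0)) * G * x i = w' * G * x l := by
    simp
  have e5 : ∀ i, ((W' i * S) + (w * U i) * (U i + ∑ j, x j * H j i)
      + (((-1 / 2) * ((w' * (if l = i then (1 : ℝ) else 0)) * G + w * ∑ j, 2 * U j * H j i)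
        + k * c * U i) * x i + ((-1 / 2) * (w * G) + P) * 1)) =
      W' i * S + (w * U i) * (U i + ∑ j, x j * H j i) +
      (-1 / 2) * ((w' * (if l = i then (1 : ℝ) else 0)) * G * x i) +
      (-1 / 2) * w * ((∑ j, 2 * U j * H j i) * x i) + k * c * (x i * U i) +
      ((-1 / 2) * (w * G) + P) := by
    intro i; ring
  simp_rw [e5]
  simp only [Finset.sum_add_distrib, ← Finset.mul_sum, ← Finset.sum_mul] at *
  rw [e2, e3, e4, hW]
  simp only [Finset.sum_const, Finset.card_univ, Fintype.card_fin, nsmul_eq_mul]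
  rw [← hS]
  ring

/-- Divergence of the Pohozaev field. -/
lemma div_V (hρ : ContDiff ℝ 1 ρ) (hp : 1 < p) (hu : ContDiff ℝ 2 u)
    (x : EuclideanSpace ℝ (Fin (n + 1)))
    (hx : divW (n + 1) (fun z => ρ (z (Fin.last n))) u x = -(a * u x ^ (p - 1))) :
    ∑ i, pd (n + 1) (Vfield ρ a p u i) i x =
      - ((((n + 1 : ℕ) : ℝ) - 2) / 2) * (ρ (x (Fin.last n)) * gsq u x)
      + ((n + 1 : ℕ) : ℝ) * (a / p * u x ^ p)
      - (1 / 2) * (x (Fin.last n) * deriv ρ (x (Fin.last n)) * gsq u x) := by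
  have d1 : ∀ {f : EuclideanSpace ℝ (Fin (n + 1)) → ℝ}, ContDiff ℝ 1 f → DifferentiableAt ℝ f x :=
    fun h => (h.differentiable (by norm_num)) x
  have hu1 : ContDiff ℝ 1 u := hu.of_le (by norm_num)
  have hp0 : p ≠ 0 := by linarith
  rw [show gsq u x = ∑ j, (fun j => pd (n + 1) u j x) j ^ 2 from rfl]
  rw [← alg_aux (Fin.last n) (fun j => x j) (fun j => pd (n + 1) u j x)
    (fun j i => pd (n + 1) (pd (n + 1) u j) i x) (fun i j => pd_symm hu i j)
    (fun i => pd (n + 1) (fun z => ρ (z (Fin.last n)) * pd (n + 1) u i z) i x)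
    (ρ (x (Fin.last n))) (deriv ρ (x (Fin.last n))) (u x ^ (p - 1)) (a / p * u x ^ p) a hx]
  refine Finset.sum_congr rfl fun i _ => ?_
  have hS : pd (n + 1) (Sdot u) i x = ∑ j, ((if j = i then 1 else 0) * pd (n + 1) u j x
      + x j * pd (n + 1) (pd (n + 1) u j) i x) := by
    unfold Sdot
    rw [pd_sum (fun j => d1 ((cd_coord j).mul (pd_cd hu j)))]
    refine Finset.sum_congr rfl fun j _ => ?_
    rw [pd_mul (d1 (cd_coord j)) (d1 (pd_cd hu j)), pd_coord]
  have hG : pd (n + 1) (gsq u) i x =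
      ∑ j, 2 * pd (n + 1) u j x * pd (n + 1) (pd (n + 1) u j) i x := by
    unfold gsq
    rw [pd_sum (fun j => d1 ((pd_cd hu j).pow 2))]
    refine Finset.sum_congr rfl fun j _ => ?_
    rw [pd_comp (r := fun s => s ^ 2) (r' := 2 * pd (n + 1) u j x)
      (by simpa using hasDerivAt_pow 2 (pd (n + 1) u j x)) (d1 (pd_cd hu j))]
  have hw : pd (n + 1) (fun z => ρ (z (Fin.last n))) i x =
      deriv ρ (x (Fin.last n)) * (if Fin.last n = i then 1 else 0) := by
    rw [pd_comp (f := fun z : EuclideanSpace ℝ (Fin (n + 1)) => z (Fin.last n)) (r := ρ)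
      ((hρ.differentiable (by norm_num)) _).hasDerivAt (d1 (cd_coord _)), pd_coord]
  have hpow : pd (n + 1) (fun z => u z ^ p) i x = p * u x ^ (p - 1) * pd (n + 1) u i x :=
    pd_comp (r := fun s => s ^ p) (Real.hasDerivAt_rpow_const (Or.inr hp.le)) (d1 hu1) i
  have hT : pd (n + 1) (Tlag ρ a p u) i x = (-1 / 2) * ((deriv ρ (x (Fin.last n)) *
      (if Fin.last n = i then 1 else 0)) * gsq u x + ρ (x (Fin.last n)) *
        ∑ j, 2 * pd (n + 1) u j x * pd (n + 1) (pd (n + 1) u j) i x)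
        + a * u x ^ (p - 1) * pd (n + 1) u i x := by
    unfold Tlag
    rw [pd_add (d1 (contDiff_const.mul ((cd_w hρ).mul (cd_gsq hu))))
      (d1 (contDiff_const.mul (cd_pow hp hu))),
      pd_const_mul _ (d1 ((cd_w hρ).mul (cd_gsq hu))), pd_const_mul _ (d1 (cd_pow hp hu)),
      pd_mul (d1 (cd_w hρ)) (d1 (cd_gsq hu)), hG, hw, hpow]
    field_simp
  unfold Vfield
  rw [pd_add (d1 (((cd_w hρ).mul (pd_cd hu i)).mul (cd_Sdot hu)))
    (d1 ((cd_Tlag hρ hp hu).mul (cd_coord i))),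
    pd_mul (d1 ((cd_w hρ).mul (pd_cd hu i))) (d1 (cd_Sdot hu)),
    pd_mul (d1 (cd_Tlag hρ hp hu)) (d1 (cd_coord i)), hS, hT, pd_coord, if_pos rfl]
  rfl

end field

/-! ### Limits with cutoffs -/

lemma lim_base {X : Type*} [MeasurableSpace X] {μ : Measure X} {N : ℕ}
    {L : X → EuclideanSpace ℝ (Fin N)} (hL : Measurable L)
    {ψ : EuclideanSpace ℝ (Fin N) → ℝ} (hψ : Continuous ψ) (hc : HasCompactSupport ψ)
    {g : X → ℝ} (hg : Integrable g μ) :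
    (∀ e : ℝ, Integrable (fun x => ψ (e • L x) * g x) μ) ∧
    ∀ e : ℕ → ℝ, Tendsto e atTop (𝓝 0) →
      Tendsto (fun k => ∫ x, ψ (e k • L x) * g x ∂μ) atTop (𝓝 (ψ 0 * ∫ x, g x ∂μ)) := by
  obtain ⟨C, hC⟩ := hψ.bounded_above_of_compact_support hc
  have hm : ∀ e : ℝ, AEStronglyMeasurable (fun x => ψ (e • L x)) μ := fun e =>
    (hψ.measurable.comp (hL.const_smul e)).aestronglyMeasurable
  refine ⟨fun e => hg.bdd_mul (hm e) (c := C) (ae_of_all _ fun x => hC _), fun e he => ?_⟩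
  rw [← integral_const_mul]
  refine tendsto_integral_of_dominated_convergence (fun x => C * ‖g x‖)
    (fun k => (hm _).mul hg.aestronglyMeasurable) (hg.norm.const_mul C)
    (fun k => ae_of_all _ fun x => ?_) (ae_of_all _ fun x => ?_)
  · rw [norm_mul]
    exact mul_le_mul_of_nonneg_right (hC _) (norm_nonneg _)
  · refine Tendsto.mul_const _ ?_
    have : Tendsto (fun k => e k • L x) atTop (𝓝 (0 : EuclideanSpace ℝ (Fin N))) := by
      simpa using he.smul_const (L x)
    exact (hψ.tendsto 0).comp this

lemma lim_sum {X ι : Type*} [Fintype ι] [MeasurableSpace X] {μ : Measure X} {N : ℕ}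
    {L : X → EuclideanSpace ℝ (Fin N)} (hL : Measurable L)
    {ψ : ι → EuclideanSpace ℝ (Fin N) → ℝ} (hψ : ∀ i, Continuous (ψ i))
    (hc : ∀ i, HasCompactSupport (ψ i)) (h0 : ∀ i, ψ i 0 = 0)
    {g : ι → X → ℝ} (hg : ∀ i, Integrable (g i) μ) :
    (∀ e : ℝ, Integrable (fun x => ∑ i, ψ i (e • L x) * g i x) μ) ∧
    ∀ e : ℕ → ℝ, Tendsto e atTop (𝓝 0) →
      Tendsto (fun k => ∫ x, ∑ i, ψ i (e k • L x) * g i x ∂μ) atTop (𝓝 0) := by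
  refine ⟨fun e => integrable_finsetSum _ fun i _ => (lim_base hL (hψ i) (hc i) (hg i)).1 e,
    fun e he => ?_⟩
  have h : ∀ k, ∫ x, ∑ i, ψ i (e k • L x) * g i x ∂μ = ∑ i, ∫ x, ψ i (e k • L x) * g i x ∂μ :=
    fun k => integral_finsetSum _ fun i _ => (lim_base hL (hψ i) (hc i) (hg i)).1 (e k)
  simp_rw [h]
  have := tendsto_finsetSum (Finset.univ : Finset ι)
    (fun i _ => (lim_base hL (hψ i) (hc i) (hg i)).2 e he)
  simpa [h0] using this

/-- `z_j ∂_i φ(z)`. -/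
def psi {N : ℕ} (φ : EuclideanSpace ℝ (Fin N) → ℝ) (j i : Fin N)
    (z : EuclideanSpace ℝ (Fin N)) : ℝ := z j * pd N φ i z

lemma psi_cont {N : ℕ} {φ : EuclideanSpace ℝ (Fin N) → ℝ} (hφ : ContDiff ℝ 1 φ) (j i : Fin N) :
    Continuous (psi φ j i) :=
  (cd_coord j).continuous.mul (pd_cont hφ i)

lemma psi_supp {N : ℕ} {φ : EuclideanSpace ℝ (Fin N) → ℝ} (hφ : HasCompactSupport φ)
    (j i : Fin N) : HasCompactSupport (psi φ j i) :=
  (pd_supp hφ i).mul_left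

lemma psi_zero {N : ℕ} {φ : EuclideanSpace ℝ (Fin N) → ℝ} (j i : Fin N) :
    psi φ j i 0 = 0 := by simp [psi]

lemma supp_scale {N : ℕ} {φ : EuclideanSpace ℝ (Fin N) → ℝ} (hφ : HasCompactSupport φ)
    {e : ℝ} (he : e ≠ 0) : HasCompactSupport (fun x => φ (e • x)) :=
  hφ.comp_isClosedEmbedding (Homeomorph.smulOfNeZero e he).isClosedEmbedding

lemma cd_scale {N : ℕ} {φ : EuclideanSpace ℝ (Fin N) → ℝ} (hφ : ContDiff ℝ 1 φ) (e : ℝ) :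
    ContDiff ℝ 1 (fun x => φ (e • x)) := hφ.comp (by fun_prop)

/-- Boundary identity. -/
lemma bdry_eps {n : ℕ} {φ v : EuclideanSpace ℝ (Fin n) → ℝ} (hφ : ContDiff ℝ 1 φ)
    (hφc : HasCompactSupport φ) (hv : ContDiff ℝ 2 v) {q : ℝ} (hq : 1 < q) {e : ℝ} (he : e ≠ 0) :
    ∫ y, φ (e • y) * (v y ^ (q - 1) * ∑ j, y j * pd n v j y) =
      -(1 / q) * ∫ y, ((n : ℝ) * (φ (e • y) * v y ^ q) + ∑ j, psi φ j j (e • y) * v y ^ q) := by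
  have d1 : ∀ {f : EuclideanSpace ℝ (Fin n) → ℝ}, ContDiff ℝ 1 f → ∀ x, DifferentiableAt ℝ f x :=
    fun h x => (h.differentiable (by norm_num)) x
  have hv1 : ContDiff ℝ 1 v := hv.of_le (by norm_num)
  have hq0 : q ≠ 0 := by linarith
  have hcs := supp_scale hφc he
  have hcd := cd_scale hφ e
  have hG : ∀ j : Fin n, ContDiff ℝ 1 (fun y => φ (e • y) * (y j * v y ^ q)) := fun j =>
    hcd.mul ((cd_coord j).mul (cd_pow hq hv))
  have hGc : ∀ j : Fin n, HasCompactSupport (fun y => φ (e • y) * (y j * v y ^ q)) := fun j =>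
    hcs.mul_right
  have h0 : ∫ y, ∑ j, pd n (fun y => φ (e • y) * (y j * v y ^ q)) j y = 0 := by
    rw [integral_finsetSum _ (fun i _ => ((pd_cont (hG i) i).integrable_of_hasCompactSupport
      (pd_supp (hGc i) i)))]
    exact Finset.sum_eq_zero fun j _ => integral_fderiv_zero _ (hG j) (hGc j) _
  have hpt : ∀ y, ∑ j, pd n (fun y => φ (e • y) * (y j * v y ^ q)) j y =
      q * (φ (e • y) * (v y ^ (q - 1) * ∑ j, y j * pd n v j y)) +
      ((n : ℝ) * (φ (e • y) * v y ^ q) + ∑ j, psi φ j j (e • y) * v y ^ q) := by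
    intro y
    have h : ∀ j, pd n (fun y => φ (e • y) * (y j * v y ^ q)) j y =
        q * φ (e • y) * v y ^ (q - 1) * (y j * pd n v j y) + φ (e • y) * v y ^ q +
        psi φ j j (e • y) * v y ^ q := by
      intro j
      rw [pd_mul (d1 hcd y) (d1 ((cd_coord j).mul (cd_pow hq hv)) y), pd_scale (d1 hφ _),
        pd_mul (d1 (cd_coord j) y) (d1 (cd_pow hq hv) y), pd_coord, if_pos rfl,
        pd_comp (r := fun s => s ^ q) (Real.hasDerivAt_rpow_const (Or.inr hq.le)) (d1 hv1 y) j]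
      simp only [psi, PiLp.smul_apply, smul_eq_mul]
      ring
    simp_rw [h]
    rw [Finset.sum_add_distrib, Finset.sum_add_distrib, ← Finset.mul_sum]
    simp only [Finset.sum_const, Finset.card_univ, Fintype.card_fin, nsmul_eq_mul]
    ring
  have hcv : Continuous (fun y => v y ^ (q - 1)) :=
    hv.continuous.rpow_const (fun _ => Or.inr (by linarith))
  have hcvq : Continuous (fun y => v y ^ q) := (cd_pow hq hv).continuous
  have i1 : Integrable (fun y => q * (φ (e • y) * (v y ^ (q - 1) * ∑ j, y j * pd n v j y))) := by
    refine Integrable.const_mul (Continuous.integrable_of_hasCompactSupport ?_ ?_) q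
    · refine hcd.continuous.mul (hcv.mul (continuous_finsetSum _ fun j _ => ?_))
      exact (cd_coord j).continuous.mul (pd_cont hv1 j)
    · exact hcs.mul_right
  have i2 : Integrable (fun y => (n : ℝ) * (φ (e • y) * v y ^ q) +
      ∑ j, psi φ j j (e • y) * v y ^ q) := by
    refine Integrable.add (Integrable.const_mul
      (Continuous.integrable_of_hasCompactSupport (hcd.continuous.mul hcvq) hcs.mul_right) _)
      (integrable_finsetSum _ fun j _ => Continuous.integrable_of_hasCompactSupport ?_ ?_)
    · exact ((psi_cont hφ j j).comp (continuous_const_smul e)).mul hcvq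
    · exact (supp_scale (psi_supp hφc j j) he).mul_right
  simp_rw [hpt] at h0
  rw [integral_add i1 i2, integral_const_mul] at h0
  have hfin : ∀ A B : ℝ, q * A + B = 0 → A = -(1 / q) * B := by
    intro A B h
    field_simp
    linarith
  exact hfin _ _ h0

lemma bdry_lim {n : ℕ} {φ v : EuclideanSpace ℝ (Fin n) → ℝ} (hφ : ContDiff ℝ 1 φ)
    (hφc : HasCompactSupport φ) (hφ0 : φ 0 = 1) (hv : ContDiff ℝ 2 v) {q : ℝ} (hq : 1 < q)
    (hi : Integrable (fun y => v y ^ q)) (e : ℕ → ℝ) (he : ∀ k, e k ≠ 0)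
    (he0 : Tendsto e atTop (𝓝 0)) :
    Tendsto (fun k => ∫ y, φ (e k • y) * (v y ^ (q - 1) * ∑ j, y j * pd n v j y)) atTop
      (𝓝 (-(n / q) * ∫ y, v y ^ q)) := by
  simp_rw [fun k => bdry_eps hφ hφc hv hq (he k)]
  have b1 := lim_base (L := fun y : EuclideanSpace ℝ (Fin n) => y) measurable_id hφ.continuous hφc hi
  have b2 := lim_sum (ι := Fin n) (L := fun y : EuclideanSpace ℝ (Fin n) => y) measurable_id
    (fun j => psi_cont hφ j j) (fun j => psi_supp hφc j j) (fun j => psi_zero j j) (fun _ => hi)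
  simp_rw [fun k => integral_add ((b1.1 (e k)).const_mul (n : ℝ)) (b2.1 (e k)), integral_const_mul]
  have := (((b1.2 e he0).const_mul (n : ℝ)).add (b2.2 e he0)).const_mul (-(1 / q))
  convert this using 2
  rw [hφ0]; ring

/-- Interior identity. -/
lemma int_eps {n : ℕ} {ρ : ℝ → ℝ} {a p : ℝ} {φ u : EuclideanSpace ℝ (Fin (n + 1)) → ℝ}
    (hφ : ContDiff ℝ 1 φ) (hφc : HasCompactSupport φ)
    (hρ : ContDiff ℝ 1 ρ) (hp : 1 < p) (hu : ContDiff ℝ 2 u)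
    (hsol : ∀ x ∈ HS n,
      divW (n + 1) (fun z => ρ (z (Fin.last n))) u x = -(a * u x ^ (p - 1)))
    {e : ℝ} (he : e ≠ 0) :
    ∫ x in HS n, (φ (e • x) * (- ((((n + 1 : ℕ) : ℝ) - 2) / 2) * (ρ (x (Fin.last n)) * gsq u x)
      + ((n + 1 : ℕ) : ℝ) * (a / p * u x ^ p)
      - (1 / 2) * (x (Fin.last n) * deriv ρ (x (Fin.last n)) * gsq u x))
      + ∑ k : Fin (n + 1) × Fin (n + 1), psi φ k.2 k.1 (e • x) *
        (ρ (x (Fin.last n)) * (pd (n + 1) u k.1 x * pd (n + 1) u k.2 x))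
      + ∑ i, psi φ i i (e • x) * Tlag ρ a p u x) =
    - ∫ y, φ (e • embL n y) * Vfield ρ a p u (Fin.last n) (embL n y) := by
  have d1 : ∀ {f : EuclideanSpace ℝ (Fin (n + 1)) → ℝ}, ContDiff ℝ 1 f →
    ∀ x, DifferentiableAt ℝ f x := fun h x => (h.differentiable (by norm_num)) x
  rw [← div_thm (fun i x => φ (e • x) * Vfield ρ a p u i x)
    (fun i => (cd_scale hφ e).mul (cd_V hρ hp hu i)) (fun i => (supp_scale hφc he).mul_right)]
  refine setIntegral_congr_fun (isOpen_HS n).measurableSet fun x hx => ?_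
  simp only
  rw [← div_V hρ hp hu x (hsol x hx), Fintype.sum_prod_type, Finset.mul_sum,
    ← Finset.sum_add_distrib, ← Finset.sum_add_distrib]
  refine Finset.sum_congr rfl fun i _ => ?_
  rw [pd_mul (d1 (cd_scale hφ e) x) (d1 (cd_V hρ hp hu i) x), pd_scale (d1 hφ _)]
  have : ∑ j, psi φ j i (e • x) * (ρ (x (Fin.last n)) * (pd (n + 1) u i x * pd (n + 1) u j x)) =
      e * pd (n + 1) φ i (e • x) * (ρ (x (Fin.last n)) * pd (n + 1) u i x) * Sdot u x := by
    unfold Sdot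
    rw [Finset.mul_sum]
    refine Finset.sum_congr rfl fun j _ => ?_
    simp only [psi, PiLp.smul_apply, smul_eq_mul]; ring
  rw [this]
  simp only [psi, PiLp.smul_apply, smul_eq_mul]
  rw [show Vfield ρ a p u i x = (ρ (x (Fin.last n)) * pd (n + 1) u i x) * Sdot u x +
    Tlag ρ a p u x * x i from rfl]
  ring

/-- The Pohozaev identity. -/
lemma pohozaev {n : ℕ} {ρ : ℝ → ℝ} {a b p q : ℝ} {u : EuclideanSpace ℝ (Fin (n + 1)) → ℝ}
    (hρ : ContDiff ℝ 1 ρ) (hρ0 : ρ 0 = 1) (hρpos : ∀ s, 0 < s → 0 ≤ ρ s)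
    (hp : 1 < p) (hq : 1 < q) (hu : ContDiff ℝ 2 u)
    (hsol : ∀ x ∈ HS n,
      divW (n + 1) (fun z => ρ (z (Fin.last n))) u x = -(a * u x ^ (p - 1)))
    (hbd : ∀ y, pd (n + 1) u (Fin.last n) (embL n y) = -(b * u (embL n y) ^ (q - 1)))
    (i1 : IntegrableOn (fun x => ρ (x (Fin.last n)) * gsq u x) (HS n))
    (i2 : IntegrableOn (fun x => u x ^ p) (HS n))
    (i3 : IntegrableOn (fun x => x (Fin.last n) * deriv ρ (x (Fin.last n)) * gsq u x) (HS n))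
    (i4 : Integrable (fun y => u (embL n y) ^ q)) :
    - ((((n + 1 : ℕ) : ℝ) - 2) / 2) * (∫ x in HS n, ρ (x (Fin.last n)) * gsq u x)
      + ((n + 1 : ℕ) : ℝ) * (a / p * ∫ x in HS n, u x ^ p)
      - (1 / 2) * (∫ x in HS n, x (Fin.last n) * deriv ρ (x (Fin.last n)) * gsq u x) =
    - (b * (n / q) * ∫ y, u (embL n y) ^ q) := by
  let χ : ContDiffBump (0 : EuclideanSpace ℝ (Fin (n + 1))) :=
    { rIn := 1, rOut := 2, rIn_pos := by norm_num, rIn_lt_rOut := by norm_num }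
  obtain ⟨φ, hφ, hφc, hφ0⟩ : ∃ φ : EuclideanSpace ℝ (Fin (n + 1)) → ℝ,
      ContDiff ℝ 1 φ ∧ HasCompactSupport φ ∧ φ 0 = 1 :=
    ⟨χ, χ.contDiff, χ.hasCompactSupport, χ.one_of_mem_closedBall (by simp [χ])⟩
  have hu1 : ContDiff ℝ 1 u := hu.of_le (by norm_num)
  -- sequence of scales
  let e : ℕ → ℝ := fun k => 1 / ((k : ℝ) + 1)
  have he : ∀ k, e k ≠ 0 := fun k => by positivity
  have he0 : Tendsto e atTop (𝓝 0) := tendsto_one_div_add_atTop_nhds_zero_nat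
  -- integrability of products
  have iT : IntegrableOn (Tlag ρ a p u) (HS n) :=
    (i1.const_mul (-1 / 2)).add (i2.const_mul (a / p))
  have iU : ∀ k : Fin (n + 1) × Fin (n + 1), IntegrableOn (fun x => ρ (x (Fin.last n)) *
      (pd (n + 1) u k.1 x * pd (n + 1) u k.2 x)) (HS n) := by
    intro k
    refine Integrable.mono' i1 ?_ ?_
    · exact ((cd_w hρ).continuous.mul
        ((pd_cont hu1 k.1).mul (pd_cont hu1 k.2))).aestronglyMeasurable
    · refine (ae_restrict_iff' (isOpen_HS n).measurableSet).mpr (ae_of_all _ fun x hx => ?_)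
      have hr := hρpos _ hx
      rw [norm_mul, Real.norm_of_nonneg hr]
      refine mul_le_mul_of_nonneg_left ?_ hr
      have h1 : ∀ i, pd (n + 1) u i x ^ 2 ≤ gsq u x := fun i =>
        Finset.single_le_sum (f := fun j => pd (n + 1) u j x ^ 2)
          (fun j _ => sq_nonneg _) (Finset.mem_univ i)
      rw [Real.norm_eq_abs, abs_le]
      constructor <;> nlinarith [h1 k.1, h1 k.2, sq_nonneg (pd (n + 1) u k.1 x + pd (n + 1) u k.2 x),
        sq_nonneg (pd (n + 1) u k.1 x - pd (n + 1) u k.2 x)]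
  have j1 := i1.const_mul (- ((((n + 1 : ℕ) : ℝ) - 2) / 2))
  have j2 := (i2.const_mul (a / p)).const_mul ((n + 1 : ℕ) : ℝ)
  have j3 := i3.const_mul (1 / 2)
  have iD := (j1.add j2).sub j3
  have b1 := lim_base (L := fun y : EuclideanSpace ℝ (Fin (n + 1)) => y) measurable_id
    hφ.continuous hφc iD
  have b2 := lim_sum (ι := Fin (n + 1) × Fin (n + 1))
    (L := fun y : EuclideanSpace ℝ (Fin (n + 1)) => y) measurable_id
    (fun k => psi_cont hφ k.2 k.1) (fun k => psi_supp hφc k.2 k.1) (fun k => psi_zero k.2 k.1) iU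
  have b3 := lim_sum (ι := Fin (n + 1)) (L := fun y : EuclideanSpace ℝ (Fin (n + 1)) => y)
    measurable_id (fun j => psi_cont hφ j j) (fun j => psi_supp hφc j j) (fun j => psi_zero j j)
    (fun _ => iT)
  have lim1 := ((b1.2 e he0).add (b2.2 e he0)).add (b3.2 e he0)
  have heq := fun k => int_eps hφ hφc hρ hp hu hsol (he k)
  have hsplit : ∀ k, _ = _ := fun k => integral_add ((b1.1 (e k)).add (b2.1 (e k))) (b3.1 (e k))
  have hsplit2 : ∀ k, _ = _ := fun k => integral_add (b1.1 (e k)) (b2.1 (e k))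
  have lim1' : Tendsto (fun k => - ∫ y, φ (e k • embL n y) *
      Vfield ρ a p u (Fin.last n) (embL n y)) atTop (𝓝 (
    - ((((n + 1 : ℕ) : ℝ) - 2) / 2) * (∫ x in HS n, ρ (x (Fin.last n)) * gsq u x)
      + ((n + 1 : ℕ) : ℝ) * (a / p * ∫ x in HS n, u x ^ p)
      - (1 / 2) * (∫ x in HS n, x (Fin.last n) * deriv ρ (x (Fin.last n)) * gsq u x))) := by
    have hval : ∫ x in HS n, (- ((((n + 1 : ℕ) : ℝ) - 2) / 2) * (ρ (x (Fin.last n)) * gsq u x)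
        + ((n + 1 : ℕ) : ℝ) * (a / p * u x ^ p)
        - (1 / 2) * (x (Fin.last n) * deriv ρ (x (Fin.last n)) * gsq u x)) =
      - ((((n + 1 : ℕ) : ℝ) - 2) / 2) * (∫ x in HS n, ρ (x (Fin.last n)) * gsq u x)
      + ((n + 1 : ℕ) : ℝ) * (a / p * ∫ x in HS n, u x ^ p)
      - (1 / 2) * (∫ x in HS n, x (Fin.last n) * deriv ρ (x (Fin.last n)) * gsq u x) := by
      rw [← integral_const_mul, ← integral_const_mul (a / p), ← integral_const_mul,
        ← integral_const_mul, ← integral_add j1 j2]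
      exact integral_sub (j1.add j2) j3
    rw [← hval]
    have : ∀ k, - ∫ y, φ (e k • embL n y) * Vfield ρ a p u (Fin.last n) (embL n y) = _ :=
      fun k => (heq k).symm.trans ((hsplit k).trans (congrArg (· + _) (hsplit2 k)))
    simp_rw [this]
    convert lim1 using 2
    rw [hφ0, one_mul, add_zero, add_zero]
    rfl
  -- boundary limit
  have hLinj : Topology.IsClosedEmbedding (embL n) := by
    have := emb_closed n 0
    simpa [asm] using this
  have hv : ContDiff ℝ 2 (fun y => u (embL n y)) := hu.comp (by fun_prop)
  have lim2 := bdry_lim (φ := fun y => φ (embL n y)) (v := fun y => u (embL n y)) (q := q)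
    (hφ.comp (by fun_prop)) (hφc.comp_isClosedEmbedding hLinj) (by simpa using hφ0) hv hq i4 e he he0
  have hpt : ∀ k, - ∫ y, φ (e k • embL n y) * Vfield ρ a p u (Fin.last n) (embL n y) =
      b * ∫ y, φ (embL n (e k • y)) * (u (embL n y) ^ (q - 1) *
        ∑ j, y j * pd n (fun y => u (embL n y)) j y) := by
    intro k
    rw [← integral_neg, ← integral_const_mul]
    congr 1
    funext y
    have hpd : ∀ j : Fin n, pd n (fun y => u (embL n y)) j y = pd (n + 1) u j.castSucc (embL n y) := by
      intro j
      have := ((hu1.differentiable (by norm_num)) (embL n y)).hasFDerivAt.comp y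
        ((embL n).hasFDerivAt (x := y))
      unfold pd
      rw [show (fun y => u (embL n y)) = u ∘ embL n from rfl, this.fderiv]
      simp [embL_single]
    have hS : Sdot u (embL n y) = ∑ j, y j * pd n (fun y => u (embL n y)) j y := by
      unfold Sdot
      rw [Fin.sum_univ_castSucc, embL_last]
      simp [embL_castSucc, hpd]
    unfold Vfield
    rw [embL_last, hρ0, hbd, hS, map_smul]
    ring
  simp_rw [hpt] at lim1'
  have := tendsto_nhds_unique lim1' (lim2.const_mul b)
  rw [this]
  ring

theorem stmt11 (N : ℕ) (hN : 3 ≤ N) (ρ : ℝ → ℝ) (hρC1 : ContDiff ℝ 1 ρ)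
    (hρzero : ρ 0 = 1) (γ : ℝ) (hγ : 0 < γ)
    (hρlow : ∀ s : ℝ, 0 ≤ s → (1 + s) ^ γ ≤ ρ s)
    (c₁ : ℝ) (hc₁ : 0 < c₁)
    (hρ1 : ∀ s : ℝ, 0 < s → 0 < deriv ρ s * s ∧ deriv ρ s * s ≤ c₁ * ρ s)
    (a b q : ℝ) (ha : 0 < a) (hb : b ≤ 0) (hq1 : 1 < q)
    (hq2 : q ≤ 2 * ((N : ℝ) - 1) / ((N : ℝ) - 2))
    (u : EuclideanSpace ℝ (Fin N) → ℝ) (hu : ContDiff ℝ 2 u)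
    (hsol : IsSolutionP0 N (by omega) ρ a b (2 * (N : ℝ) / ((N : ℝ) - 2)) q u)
    (hpos : ∀ x, 0 ≤ xN N (by omega) x → 0 ≤ u x)
    (henergy : IntegrableOn (fun x => ρ (xN N (by omega) x) * ‖gradient u x‖ ^ 2)
      (Hplus N (by omega)) volume)
    (hLp : IntegrableOn (fun x => |u x| ^ (2 * (N : ℝ) / ((N : ℝ) - 2)))
      (Hplus N (by omega)) volume)
    (hLq : Integrable (fun y : EuclideanSpace ℝ (Fin (N - 1)) => |u (bPt N y)| ^ q))
    (hident : (∫ x in Hplus N (by omega),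
        ρ (xN N (by omega) x) * ‖gradient u x‖ ^ 2) =
      a * (∫ x in Hplus N (by omega), u x ^ (2 * (N : ℝ) / ((N : ℝ) - 2))) +
        b * ∫ y : EuclideanSpace ℝ (Fin (N - 1)), u (bPt N y) ^ q) :
    ∀ x, 0 ≤ xN N (by omega) x → u x = 0 := by
  obtain ⟨n, rfl⟩ : ∃ n, N = n + 1 := ⟨N - 1, by omega⟩
  have hn2 : (2 : ℝ) ≤ n := by
    have : 2 ≤ n := by omega
    exact_mod_cast this
  have hcast : ((n + 1 : ℕ) : ℝ) = n + 1 := by push_cast; ring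
  have hxN : ∀ (h : 0 < n + 1) (x : EuclideanSpace ℝ (Fin (n + 1))),
      xN (n + 1) h x = x (Fin.last n) := fun _ _ => rfl
  have hHS : ∀ h : 0 < n + 1, Hplus (n + 1) h = HS n := fun _ => rfl
  have hgr : ∀ x, ‖gradient u x‖ ^ 2 = gsq u x := fun x => norm_gradient_sq
  obtain ⟨p, hpdef⟩ : ∃ p, p = 2 * ((n + 1 : ℕ) : ℝ) / (((n + 1 : ℕ) : ℝ) - 2) := ⟨_, rfl⟩
  rw [← hpdef] at hsol hLp hident
  simp only [hxN, hHS, hgr] at *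
  have hp1 : 1 < p := by
    rw [hpdef, hcast, lt_div_iff₀ (by linarith)]; linarith
  have hpnn : ∀ x ∈ HS n, 0 ≤ u x := fun x hx => hpos x (le_of_lt hx)
  have hbnn : ∀ y : EuclideanSpace ℝ (Fin n), 0 ≤ u (embL n y) :=
    fun y => hpos _ (by rw [embL_last])
  have habs : ∀ s r : ℝ, 0 ≤ s → 1 < r → |s| ^ (r - 2) * s = s ^ (r - 1) := by
    intro s r hs hr
    rw [abs_of_nonneg hs]
    rcases hs.eq_or_lt with rfl | hs
    · rw [Real.zero_rpow (by linarith : r - 1 ≠ 0)]; simp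
    · rw [show r - 1 = (r - 2) + 1 by ring, Real.rpow_add_one hs.ne']
  have hρpos : ∀ s, 0 < s → 0 < ρ s := fun s hs =>
    lt_of_lt_of_le (Real.rpow_pos_of_pos (by linarith) _) (hρlow s hs.le)
  have hu1 : ContDiff ℝ 1 u := hu.of_le (by norm_num)
  have hgc : Continuous (gsq u) := (cd_gsq hu).continuous
  have hgnn : ∀ x, 0 ≤ gsq u x := fun x => Finset.sum_nonneg fun j _ => sq_nonneg _
  have hlc : Continuous (fun x : EuclideanSpace ℝ (Fin (n + 1)) => x (Fin.last n)) :=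
    (cd_coord (Fin.last n)).continuous
  have hMc : Continuous (fun x : EuclideanSpace ℝ (Fin (n + 1)) =>
      x (Fin.last n) * deriv ρ (x (Fin.last n)) * gsq u x) :=
    (hlc.mul ((hρC1.continuous_deriv (by norm_num)).comp hlc)).mul hgc
  have hHm := (isOpen_HS n).measurableSet
  have i2 : IntegrableOn (fun x => u x ^ p) (HS n) :=
    hLp.congr_fun (fun x hx => by simp only [abs_of_nonneg (hpnn x hx)]) hHm
  have i4 : Integrable (fun y : EuclideanSpace ℝ (Fin n) => u (embL n y) ^ q) := by
    refine hLq.congr (ae_of_all _ fun y => ?_)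
    show |u (embL n y)| ^ q = _
    rw [abs_of_nonneg (hbnn y)]
  have i3 : IntegrableOn (fun x => x (Fin.last n) * deriv ρ (x (Fin.last n)) * gsq u x) (HS n) := by
    refine Integrable.mono' (henergy.const_mul c₁) hMc.aestronglyMeasurable ?_
    refine (ae_restrict_iff' hHm).mpr (ae_of_all _ fun x hx => ?_)
    have h := hρ1 _ hx
    rw [mul_comm (x (Fin.last n)), Real.norm_of_nonneg (mul_nonneg h.1.le (hgnn x)), ← mul_assoc]
    exact mul_le_mul_of_nonneg_right h.2 (hgnn x)
  have hsolI : ∀ x ∈ HS n,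
      divW (n + 1) (fun z => ρ (z (Fin.last n))) u x = -(a * u x ^ (p - 1)) := by
    intro x hx
    have h := hsol.1 x hx
    rw [mul_assoc, habs _ _ (hpnn x hx) hp1] at h
    have h' : - divW (n + 1) (fun z => ρ (z (Fin.last n))) u x = a * u x ^ (p - 1) := h
    linarith
  have hbd : ∀ y : EuclideanSpace ℝ (Fin n),
      pd (n + 1) u (Fin.last n) (embL n y) = -(b * u (embL n y) ^ (q - 1)) := by
    intro y
    have h : -pd (n + 1) u (Fin.last n) (embL n y) =
      b * |u (embL n y)| ^ (q - 2) * u (embL n y) := hsol.2 y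
    rw [mul_assoc, habs _ _ (hbnn y) hq1] at h
    linarith
  have hP := pohozaev hρC1 hρzero (fun s hs => (hρpos s hs).le) hp1 hq1 hu hsolI hbd henergy i2 i3 i4
  have hid : (∫ x in HS n, ρ (x (Fin.last n)) * gsq u x) = a * (∫ x in HS n, u x ^ p) +
      b * ∫ y, u (embL n y) ^ q := hident
  have hQ : 0 ≤ ∫ y, u (embL n y) ^ q :=
    integral_nonneg fun y => Real.rpow_nonneg (hbnn y) _
  set Q := ∫ y, u (embL n y) ^ q with hQdef
  have hMle : ∫ x in HS n, x (Fin.last n) * deriv ρ (x (Fin.last n)) * gsq u x ≤ 0 := by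
    have hap : ((n + 1 : ℕ) : ℝ) * (a / p * ∫ x in HS n, u x ^ p) =
        ((n : ℝ) - 1) / 2 * (a * ∫ x in HS n, u x ^ p) := by
      have h1 : (n : ℝ) + 1 ≠ 0 := by linarith
      have h2 : (n : ℝ) + 1 - 2 ≠ 0 := by
        intro h; linarith
      have hpp : ((n : ℝ) + 1) / p = ((n : ℝ) - 1) / 2 := by
        rw [hpdef, hcast]; field_simp; ring
      rw [hcast, ← hpp]; ring
    rw [hap, hid, hcast] at hP
    have hk : 0 ≤ (n : ℝ) / q - ((n : ℝ) - 1) / 2 := by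
      rw [hcast, le_div_iff₀ (by linarith)] at hq2
      rw [sub_nonneg, div_le_div_iff₀ (by norm_num) (by linarith)]
      linarith
    have hbk : b * Q * ((n : ℝ) / q - ((n : ℝ) - 1) / 2) ≤ 0 :=
      mul_nonpos_of_nonpos_of_nonneg (mul_nonpos_of_nonpos_of_nonneg hb hQ) hk
    nlinarith [hP, hbk]
  have hMnn : ∀ x ∈ HS n, 0 ≤ x (Fin.last n) * deriv ρ (x (Fin.last n)) * gsq u x := by
    intro x hx
    rw [mul_comm (x (Fin.last n))]
    exact mul_nonneg (hρ1 _ hx).1.le (hgnn x)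
  have hae := (setIntegral_eq_zero_iff_of_nonneg_ae
    ((ae_restrict_iff' hHm).mpr (ae_of_all _ hMnn)) i3).mp
    (le_antisymm hMle (setIntegral_nonneg hHm hMnn))
  have hM0 := Measure.eqOn_open_of_ae_eq hae (isOpen_HS n) hMc.continuousOn continuousOn_const
  have hg0 : ∀ x ∈ HS n, gsq u x = 0 := by
    intro x hx
    have h : x (Fin.last n) * deriv ρ (x (Fin.last n)) * gsq u x = 0 := hM0 hx
    rw [mul_comm (x (Fin.last n))] at h
    exact (mul_eq_zero.mp h).resolve_left (hρ1 _ hx).1.ne'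
  have hf0 : (HS n).EqOn (fderiv ℝ u) 0 := by
    intro x hx
    have h := hg0 x hx
    rw [show gsq u x = ‖gradient u x‖ ^ 2 from norm_gradient_sq.symm] at h
    have h' : gradient u x = 0 := by simpa using h
    have := (InnerProductSpace.toDual ℝ (EuclideanSpace ℝ (Fin (n + 1)))).symm.map_eq_zero_iff.mp
      (show (InnerProductSpace.toDual ℝ _).symm (fderiv ℝ u x) = 0 from h')
    simpa using this
  have hconv : Convex ℝ (HS n) := by
    intro x hx y hy s t hs ht hst
    simp only [HS, Set.mem_ofPred_eq, PiLp.add_apply, PiLp.smul_apply, smul_eq_mul] at *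
    rcases hs.eq_or_lt with rfl | hs
    · have : t = 1 := by linarith
      subst this; simpa using hy
    · have := mul_pos hs hx
      have := mul_nonneg ht hy.le
      linarith
  obtain ⟨c, hc⟩ := (isOpen_HS n).exists_is_const_of_fderiv_eq_zero hconv.isPreconnected
    (hu1.differentiable (by norm_num)).differentiableOn hf0
  have hc0 : c = 0 := by
    by_contra hne
    have hic : IntegrableOn (fun _ => c ^ p) (HS n) :=
      i2.congr_fun (fun x hx => by simp only [hc x hx]) hHm
    rw [integrableOn_const_iff] at hic
    rcases hic with h | h
    · have hcn : 0 ≤ c := by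
        have hm : eLast n ∈ HS n := by simp [HS, eLast]
        rw [← hc _ hm]; exact hpnn _ hm
      have := Real.rpow_pos_of_pos (lt_of_le_of_ne hcn (Ne.symm hne)) p
      exact this.ne' (by simpa using h)
    · rw [volume_HS] at h; exact lt_irrefl _ h
  intro x hx
  have hmem : ∀ t : ℝ, 0 < t → u (x + t • eLast n) = 0 := by
    intro t ht
    rw [← hc0]
    apply hc
    simp only [HS, Set.mem_ofPred_eq, eLast, PiLp.add_apply, PiLp.smul_apply, smul_eq_mul]
    simp
    linarith
  have hcont : Continuous (fun t : ℝ => u (x + t • eLast n)) :=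
    hu.continuous.comp (by fun_prop)
  have ht : Tendsto (fun t : ℝ => u (x + t • eLast n)) (𝓝[>] 0) (𝓝 (u x)) := by
    have := (hcont.tendsto 0).mono_left (nhdsWithin_le_nhds (s := Set.Ioi 0))
    simpa using this
  refine tendsto_nhds_unique ht (Tendsto.congr' ?_ tendsto_const_nhds)
  filter_upwards [self_mem_nhdsWithin] with t ht
  exact (hmem t ht).symm
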